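/- The pair (R̃_{Λ₁}, h_{Λ₁}) with R̃_{Λ₁} = (t₀t₁)^{-1/2}·R_{Λ₁} and h_{Λ₁} = (t₀t₁)^{1/2}·diag(1,−1,−1,1) is an enhanced R-matrix: it satisfies the commutation identity R̃∘(h⊗h) = (h⊗h)∘R̃, the partial trace identities tr₂((id⊗h)∘R̃^{±1}) = id, the rotation identity (R̃^{-1})^{↺}∘((id⊗h)∘R̃∘(h^{-1}⊗id))^{↻} = id, and the Yang–Baxter equation. -/

import Mathlib

open Matrix Kronecker

noncomputable section

variable {K : Type*} [Field K]

/-- `A ⊗ id` acting on factors 1,2 of a triple tensor product (matrix form). -/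
def lift12 {α : Type*} [DecidableEq α] (A : Matrix (α × α) (α × α) K) :
    Matrix (α × α × α) (α × α × α) K :=
  Matrix.of fun p q => A (p.1, p.2.1) (q.1, q.2.1) * (if p.2.2 = q.2.2 then 1 else 0)

/-- `id ⊗ A` acting on factors 2,3 of a triple tensor product (matrix form). -/
def lift23 {α : Type*} [DecidableEq α] (A : Matrix (α × α) (α × α) K) :
    Matrix (α × α × α) (α × α × α) K :=
  Matrix.of fun p q => (if p.1 = q.1 then 1 else 0) * A p.2 q.2

/-- Partial trace over the second tensor factor. -/
def ptr2 {α β : Type*} [Fintype β] (f : Matrix (α × β) (α × β) K) : Matrix α α K :=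
  Matrix.of fun k i => ∑ j, f (k, j) (i, j)

/-- The left rotation `A^↺`, with `(A^↺)_{(k,i)}^{(l,j)} = A_{(i,j)}^{(k,l)}`
(rows = upper indices). -/
def rotL {α : Type*} (A : Matrix (α × α) (α × α) K) : Matrix (α × α) (α × α) K :=
  Matrix.of fun r c => A (c.1, r.1) (c.2, r.2)

/-- The right rotation `A^↻`, with `(A^↻)_{(j,l)}^{(i,k)} = A_{(i,j)}^{(k,l)}`. -/
def rotR {α : Type*} (A : Matrix (α × α) (α × α) K) : Matrix (α × α) (α × α) K :=
  Matrix.of fun r c => A (r.2, c.2) (r.1, c.1)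

/-- The rigid R-matrix `R_{Λ₁}` of the `Λ₁`-polynomial, in the basis `(x_i ⊗ x_j)` of `X ⊗ X` (entry function: row pair `(k,l)` then column pair `(i,j)`, 0-based). -/
def RL1E (t0 t1 r : K) : ℕ → ℕ → ℕ → ℕ → K
  | 0, 0, 0, 0 => 1
  | 0, 1, 1, 0 => 1
  | 0, 2, 2, 0 => 1
  | 0, 3, 3, 0 => 1
  | 1, 0, 0, 1 => t0
  | 1, 0, 1, 0 => 1 - t0
  | 1, 1, 1, 1 => -t0
  | 1, 2, 2, 1 => t0 * r
  | 1, 2, 3, 0 => 1 - t0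
  | 1, 3, 3, 1 => -(t0 * r)
  | 2, 0, 0, 2 => t1
  | 2, 0, 2, 0 => 1 - t1
  | 2, 1, 1, 2 => t1 * r⁻¹
  | 2, 1, 3, 0 => (1 - t1) * r⁻¹
  | 2, 2, 2, 2 => -t1
  | 2, 3, 3, 2 => -(t1 * r⁻¹)
  | 3, 0, 0, 3 => t0 * t1
  | 3, 0, 1, 2 => (1 - t0) * t1
  | 3, 0, 2, 1 => t0 * (1 - t1) * r
  | 3, 0, 3, 0 => (1 - t0) * (1 - t1)
  | 3, 1, 1, 3 => -(t0 * t1 * r⁻¹)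
  | 3, 1, 3, 1 => -(t0 * (1 - t1))
  | 3, 2, 2, 3 => -(t0 * t1 * r)
  | 3, 2, 3, 2 => -(t1 * (1 - t0))
  | 3, 3, 3, 3 => t0 * t1
  | _, _, _, _ => 0

/-- The rigid R-matrix `R_{Λ₁}` of the `Λ₁`-polynomial, in the basis `(x_i ⊗ x_j)` of `X ⊗ X`. -/
def RL1 (t0 t1 r : K) : Matrix (Fin 4 × Fin 4) (Fin 4 × Fin 4) K :=
  Matrix.of fun p q => RL1E t0 t1 r p.1.val p.2.val q.1.val q.2.val

/-- The normalized Λ₁ R-matrix `R̃_{Λ₁} = (t₀t₁)^{-1/2}·R_{Λ₁}`, with `s0 = t₀^{1/2}`,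
`s1 = t₁^{1/2}`. -/
def RL1til (s0 s1 r : K) : Matrix (Fin 4 × Fin 4) (Fin 4 × Fin 4) K :=
  (s0 * s1)⁻¹ • RL1 (s0 ^ 2) (s1 ^ 2) r

/-- The enhancement `h_{Λ₁} = (t₀t₁)^{1/2}·diag(1,-1,-1,1)`. -/
def hL1 (s0 s1 : K) : Matrix (Fin 4) (Fin 4) K := (s0 * s1) • Matrix.diagonal ![1, -1, -1, 1]

set_option maxHeartbeats 8000000

lemma forall4 {P : Fin 4 → Prop} (h : P 0 ∧ P 1 ∧ P 2 ∧ P 3) (a : Fin 4) : P a := by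
  obtain ⟨h0, h1, h2, h3⟩ := h
  fin_cases a <;> assumption

/-- Table of the entries of `R_{Λ₁}`. -/
def RTab (t0 t1 r : K) : Fin 4 → Fin 4 → Fin 4 → Fin 4 → K
  | 0, 0 => ![![1, 0, 0, 0], ![0, 0, 0, 0], ![0, 0, 0, 0], ![0, 0, 0, 0]]
  | 0, 1 => ![![0, 0, 0, 0], ![1, 0, 0, 0], ![0, 0, 0, 0], ![0, 0, 0, 0]]
  | 0, 2 => ![![0, 0, 0, 0], ![0, 0, 0, 0], ![1, 0, 0, 0], ![0, 0, 0, 0]]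
  | 0, 3 => ![![0, 0, 0, 0], ![0, 0, 0, 0], ![0, 0, 0, 0], ![1, 0, 0, 0]]
  | 1, 0 => ![![0, t0, 0, 0], ![1 - t0, 0, 0, 0], ![0, 0, 0, 0], ![0, 0, 0, 0]]
  | 1, 1 => ![![0, 0, 0, 0], ![0, -t0, 0, 0], ![0, 0, 0, 0], ![0, 0, 0, 0]]
  | 1, 2 => ![![0, 0, 0, 0], ![0, 0, 0, 0], ![0, t0 * r, 0, 0], ![1 - t0, 0, 0, 0]]
  | 1, 3 => ![![0, 0, 0, 0], ![0, 0, 0, 0], ![0, 0, 0, 0], ![0, -(t0 * r), 0, 0]]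
  | 2, 0 => ![![0, 0, t1, 0], ![0, 0, 0, 0], ![1 - t1, 0, 0, 0], ![0, 0, 0, 0]]
  | 2, 1 => ![![0, 0, 0, 0], ![0, 0, t1 * r⁻¹, 0], ![0, 0, 0, 0], ![(1 - t1) * r⁻¹, 0, 0, 0]]
  | 2, 2 => ![![0, 0, 0, 0], ![0, 0, 0, 0], ![0, 0, -t1, 0], ![0, 0, 0, 0]]
  | 2, 3 => ![![0, 0, 0, 0], ![0, 0, 0, 0], ![0, 0, 0, 0], ![0, 0, -(t1 * r⁻¹), 0]]
  | 3, 0 => ![![0, 0, 0, t0 * t1], ![0, 0, (1 - t0) * t1, 0], ![0, t0 * (1 - t1) * r, 0, 0], ![(1 - t0) * (1 - t1), 0, 0, 0]]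
  | 3, 1 => ![![0, 0, 0, 0], ![0, 0, 0, -(t0 * t1 * r⁻¹)], ![0, 0, 0, 0], ![0, -(t0 * (1 - t1)), 0, 0]]
  | 3, 2 => ![![0, 0, 0, 0], ![0, 0, 0, 0], ![0, 0, 0, -(t0 * t1 * r)], ![0, 0, -(t1 * (1 - t0)), 0]]
  | 3, 3 => ![![0, 0, 0, 0], ![0, 0, 0, 0], ![0, 0, 0, 0], ![0, 0, 0, t0 * t1]]

/-- Table of the entries of `t₀ t₁ · R_{Λ₁}⁻¹`. -/
def STab (t0 t1 r : K) : Fin 4 → Fin 4 → Fin 4 → Fin 4 → K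
  | 0, 0 => ![![t0 * t1, 0, 0, 0], ![0, 0, 0, 0], ![0, 0, 0, 0], ![0, 0, 0, 0]]
  | 0, 1 => ![![0, t1 * (t0 - 1), 0, 0], ![t1, 0, 0, 0], ![0, 0, 0, 0], ![0, 0, 0, 0]]
  | 0, 2 => ![![0, 0, t0 * (t1 - 1), 0], ![0, 0, 0, 0], ![t0, 0, 0, 0], ![0, 0, 0, 0]]
  | 0, 3 => ![![0, 0, 0, (t0 - 1) * (t1 - 1)], ![0, 0, t1 - 1, 0], ![0, (t0 - 1) * r, 0, 0], ![1, 0, 0, 0]]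
  | 1, 0 => ![![0, t0 * t1, 0, 0], ![0, 0, 0, 0], ![0, 0, 0, 0], ![0, 0, 0, 0]]
  | 1, 1 => ![![0, 0, 0, 0], ![0, -t1, 0, 0], ![0, 0, 0, 0], ![0, 0, 0, 0]]
  | 1, 2 => ![![0, 0, 0, t0 * (t1 - 1)], ![0, 0, 0, 0], ![0, t0 * r, 0, 0], ![0, 0, 0, 0]]
  | 1, 3 => ![![0, 0, 0, 0], ![0, 0, 0, 1 - t1], ![0, 0, 0, 0], ![0, -r, 0, 0]]
  | 2, 0 => ![![0, 0, t0 * t1, 0], ![0, 0, 0, 0], ![0, 0, 0, 0], ![0, 0, 0, 0]]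
  | 2, 1 => ![![0, 0, 0, t1 * (t0 - 1) * r⁻¹], ![0, 0, t1 * r⁻¹, 0], ![0, 0, 0, 0], ![0, 0, 0, 0]]
  | 2, 2 => ![![0, 0, 0, 0], ![0, 0, 0, 0], ![0, 0, -t0, 0], ![0, 0, 0, 0]]
  | 2, 3 => ![![0, 0, 0, 0], ![0, 0, 0, 0], ![0, 0, 0, 1 - t0], ![0, 0, -r⁻¹, 0]]
  | 3, 0 => ![![0, 0, 0, t0 * t1], ![0, 0, 0, 0], ![0, 0, 0, 0], ![0, 0, 0, 0]]
  | 3, 1 => ![![0, 0, 0, 0], ![0, 0, 0, -(t1 * r⁻¹)], ![0, 0, 0, 0], ![0, 0, 0, 0]]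
  | 3, 2 => ![![0, 0, 0, 0], ![0, 0, 0, 0], ![0, 0, 0, -(t0 * r)], ![0, 0, 0, 0]]
  | 3, 3 => ![![0, 0, 0, 0], ![0, 0, 0, 0], ![0, 0, 0, 0], ![0, 0, 0, 1]]

/-- The matrix `t₀ t₁ · R_{Λ₁}⁻¹`. -/
def SL1 (t0 t1 r : K) : Matrix (Fin 4 × Fin 4) (Fin 4 × Fin 4) K :=
  Matrix.of fun p q => STab t0 t1 r p.1 p.2 q.1 q.2

/-- Conjugated version of `R_{Λ₁}` entering the rotation identity. -/
def ML1 (t0 t1 r : K) : Matrix (Fin 4 × Fin 4) (Fin 4 × Fin 4) K :=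
  Matrix.of fun p q => ![1, -1, -1, 1] p.2 * RL1 t0 t1 r p q * ![1, -1, -1, 1] q.1

lemma RL1_apply (t0 t1 r : K) (p q : Fin 4 × Fin 4) :
    RL1 t0 t1 r p q = RTab t0 t1 r p.1 p.2 q.1 q.2 := by
  obtain ⟨a, b⟩ := p
  obtain ⟨i, j⟩ := q
  fin_cases a <;> fin_cases b <;> fin_cases i <;> fin_cases j <;> rfl

/-- Sparse action of `R_{Λ₁}`. -/
def Rrow (t0 t1 r : K) (v : Fin 4 → Fin 4 → K) : Fin 4 → Fin 4 → K
  | 0, 0 => v 0 0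
  | 0, 1 => v 1 0
  | 0, 2 => v 2 0
  | 0, 3 => v 3 0
  | 1, 0 => (t0) * v 0 1 + (1 - t0) * v 1 0
  | 1, 1 => (-t0) * v 1 1
  | 1, 2 => (t0 * r) * v 2 1 + (1 - t0) * v 3 0
  | 1, 3 => (-(t0 * r)) * v 3 1
  | 2, 0 => (t1) * v 0 2 + (1 - t1) * v 2 0
  | 2, 1 => (t1 * r⁻¹) * v 1 2 + ((1 - t1) * r⁻¹) * v 3 0
  | 2, 2 => (-t1) * v 2 2
  | 2, 3 => (-(t1 * r⁻¹)) * v 3 2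
  | 3, 0 => (t0 * t1) * v 0 3 + ((1 - t0) * t1) * v 1 2 + (t0 * (1 - t1) * r) * v 2 1 + ((1 - t0) * (1 - t1)) * v 3 0
  | 3, 1 => (-(t0 * t1 * r⁻¹)) * v 1 3 + (-(t0 * (1 - t1))) * v 3 1
  | 3, 2 => (-(t0 * t1 * r)) * v 2 3 + (-(t1 * (1 - t0))) * v 3 2
  | 3, 3 => (t0 * t1) * v 3 3

/-- Sparse action of `SL1`. -/
def Srow (t0 t1 r : K) (v : Fin 4 → Fin 4 → K) : Fin 4 → Fin 4 → K
  | 0, 0 => (t0 * t1) * v 0 0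
  | 0, 1 => (t1 * (t0 - 1)) * v 0 1 + (t1) * v 1 0
  | 0, 2 => (t0 * (t1 - 1)) * v 0 2 + (t0) * v 2 0
  | 0, 3 => ((t0 - 1) * (t1 - 1)) * v 0 3 + (t1 - 1) * v 1 2 + ((t0 - 1) * r) * v 2 1 + v 3 0
  | 1, 0 => (t0 * t1) * v 0 1
  | 1, 1 => (-t1) * v 1 1
  | 1, 2 => (t0 * (t1 - 1)) * v 0 3 + (t0 * r) * v 2 1
  | 1, 3 => (1 - t1) * v 1 3 + (-r) * v 3 1
  | 2, 0 => (t0 * t1) * v 0 2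
  | 2, 1 => (t1 * (t0 - 1) * r⁻¹) * v 0 3 + (t1 * r⁻¹) * v 1 2
  | 2, 2 => (-t0) * v 2 2
  | 2, 3 => (1 - t0) * v 2 3 + (-r⁻¹) * v 3 2
  | 3, 0 => (t0 * t1) * v 0 3
  | 3, 1 => (-(t1 * r⁻¹)) * v 1 3
  | 3, 2 => (-(t0 * r)) * v 2 3
  | 3, 3 => v 3 3

/-- Sparse action of `rotL SL1`. -/
def LSrow (t0 t1 r : K) (v : Fin 4 → Fin 4 → K) : Fin 4 → Fin 4 → K
  | 0, 0 => (t0 * t1) * v 0 0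
  | 0, 1 => (t0 * t1) * v 1 0
  | 0, 2 => (t0 * t1) * v 2 0
  | 0, 3 => (t0 * t1) * v 3 0
  | 1, 0 => (t1) * v 0 1
  | 1, 1 => (t1 * (t0 - 1)) * v 0 0 + (-t1) * v 1 1
  | 1, 2 => (t1 * r⁻¹) * v 2 1
  | 1, 3 => (t1 * (t0 - 1) * r⁻¹) * v 2 0 + (-(t1 * r⁻¹)) * v 3 1
  | 2, 0 => (t0) * v 0 2
  | 2, 1 => (t0 * r) * v 1 2
  | 2, 2 => (t0 * (t1 - 1)) * v 0 0 + (-t0) * v 2 2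
  | 2, 3 => (t0 * (t1 - 1)) * v 1 0 + (-(t0 * r)) * v 3 2
  | 3, 0 => v 0 3
  | 3, 1 => ((t0 - 1) * r) * v 0 2 + (-r) * v 1 3
  | 3, 2 => (t1 - 1) * v 0 1 + (-r⁻¹) * v 2 3
  | 3, 3 => ((t0 - 1) * (t1 - 1)) * v 0 0 + (1 - t1) * v 1 1 + (1 - t0) * v 2 2 + v 3 3

/-- Sparse action of `rotR ML1`. -/
def RMrow (t0 t1 r : K) (v : Fin 4 → Fin 4 → K) : Fin 4 → Fin 4 → K
  | 0, 0 => v 0 0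
  | 0, 1 => (t0) * v 1 0
  | 0, 2 => (t1) * v 2 0
  | 0, 3 => (t0 * t1) * v 3 0
  | 1, 0 => v 0 1
  | 1, 1 => (-(1 - t0)) * v 0 0 + (-t0) * v 1 1
  | 1, 2 => (t1 * r⁻¹) * v 2 1
  | 1, 3 => (-((1 - t0) * t1)) * v 2 0 + (-(t0 * t1 * r⁻¹)) * v 3 1
  | 2, 0 => v 0 2
  | 2, 1 => (t0 * r) * v 1 2
  | 2, 2 => (-(1 - t1)) * v 0 0 + (-t1) * v 2 2
  | 2, 3 => (-(t0 * (1 - t1) * r)) * v 1 0 + (-(t0 * t1 * r)) * v 3 2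
  | 3, 0 => v 0 3
  | 3, 1 => (-(1 - t0)) * v 0 2 + (-(t0 * r)) * v 1 3
  | 3, 2 => (-((1 - t1) * r⁻¹)) * v 0 1 + (-(t1 * r⁻¹)) * v 2 3
  | 3, 3 => ((1 - t0) * (1 - t1)) * v 0 0 + (-(-(t0 * (1 - t1)))) * v 1 1 + (-(-(t1 * (1 - t0)))) * v 2 2 + (t0 * t1) * v 3 3

lemma Rrow_eq (t0 t1 r : K) (v : Fin 4 × Fin 4 → K) (a b : Fin 4) :
    (RL1 t0 t1 r *ᵥ v) (a, b) = Rrow t0 t1 r (fun p q => v (p, q)) a b := by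
  revert a b
  refine forall4 ⟨forall4 ⟨?_, ?_, ?_, ?_⟩, forall4 ⟨?_, ?_, ?_, ?_⟩,
    forall4 ⟨?_, ?_, ?_, ?_⟩, forall4 ⟨?_, ?_, ?_, ?_⟩⟩ <;>
    simp [Matrix.mulVec, dotProduct, Fintype.sum_prod_type, Fin.sum_univ_four, RL1_apply, RTab, Rrow]

lemma Srow_eq (t0 t1 r : K) (v : Fin 4 × Fin 4 → K) (a b : Fin 4) :
    (SL1 t0 t1 r *ᵥ v) (a, b) = Srow t0 t1 r (fun p q => v (p, q)) a b := by
  revert a b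
  refine forall4 ⟨forall4 ⟨?_, ?_, ?_, ?_⟩, forall4 ⟨?_, ?_, ?_, ?_⟩,
    forall4 ⟨?_, ?_, ?_, ?_⟩, forall4 ⟨?_, ?_, ?_, ?_⟩⟩ <;>
    simp [Matrix.mulVec, dotProduct, Fintype.sum_prod_type, Fin.sum_univ_four, SL1, STab, Srow]

lemma LSrow_eq (t0 t1 r : K) (v : Fin 4 × Fin 4 → K) (a b : Fin 4) :
    (rotL (SL1 t0 t1 r) *ᵥ v) (a, b) = LSrow t0 t1 r (fun p q => v (p, q)) a b := by
  revert a b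
  refine forall4 ⟨forall4 ⟨?_, ?_, ?_, ?_⟩, forall4 ⟨?_, ?_, ?_, ?_⟩,
    forall4 ⟨?_, ?_, ?_, ?_⟩, forall4 ⟨?_, ?_, ?_, ?_⟩⟩ <;>
    simp [Matrix.mulVec, dotProduct, Fintype.sum_prod_type, Fin.sum_univ_four, rotL, SL1, STab, LSrow]

lemma RMrow_eq (t0 t1 r : K) (v : Fin 4 × Fin 4 → K) (a b : Fin 4) :
    (rotR (ML1 t0 t1 r) *ᵥ v) (a, b) = RMrow t0 t1 r (fun p q => v (p, q)) a b := by
  revert a b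
  refine forall4 ⟨forall4 ⟨?_, ?_, ?_, ?_⟩, forall4 ⟨?_, ?_, ?_, ?_⟩,
    forall4 ⟨?_, ?_, ?_, ?_⟩, forall4 ⟨?_, ?_, ?_, ?_⟩⟩ <;>
    simp [Matrix.mulVec, dotProduct, Fintype.sum_prod_type, Fin.sum_univ_four, rotR, ML1, RL1_apply, RTab, RMrow] <;> ring

lemma mul_SL1 (t0 t1 r : K) (hr : r ≠ 0) :
    RL1 t0 t1 r * SL1 t0 t1 r = (t0 * t1) • 1 := by
  rw [Matrix.ext_iff_mulVec]
  intro v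
  rw [← Matrix.mulVec_mulVec, Matrix.smul_mulVec, Matrix.one_mulVec]
  ext ⟨a, b⟩
  simp only [Rrow_eq, Srow_eq, Pi.smul_apply, smul_eq_mul]
  revert a b
  refine forall4 ⟨forall4 ⟨?_, ?_, ?_, ?_⟩, forall4 ⟨?_, ?_, ?_, ?_⟩,
    forall4 ⟨?_, ?_, ?_, ?_⟩, forall4 ⟨?_, ?_, ?_, ?_⟩⟩ <;>
    simp only [Rrow, Srow] <;> first | ring1 | (field_simp <;> ring1)

lemma rot_mul (t0 t1 r : K) (hr : r ≠ 0) :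
    rotL (SL1 t0 t1 r) * rotR (ML1 t0 t1 r) = (t0 * t1) • 1 := by
  rw [Matrix.ext_iff_mulVec]
  intro v
  rw [← Matrix.mulVec_mulVec, Matrix.smul_mulVec, Matrix.one_mulVec]
  ext ⟨a, b⟩
  simp only [LSrow_eq, RMrow_eq, Pi.smul_apply, smul_eq_mul]
  revert a b
  refine forall4 ⟨forall4 ⟨?_, ?_, ?_, ?_⟩, forall4 ⟨?_, ?_, ?_, ?_⟩,
    forall4 ⟨?_, ?_, ?_, ?_⟩, forall4 ⟨?_, ?_, ?_, ?_⟩⟩ <;>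
    simp only [LSrow, RMrow] <;> first | ring1 | (field_simp <;> ring1)

lemma Rrow_sum (t0 t1 r : K) (v : Fin 4 → Fin 4 → K) (a b : Fin 4) :
    ∑ p : Fin 4, ∑ q : Fin 4, RL1 t0 t1 r (a, b) (p, q) * v p q = Rrow t0 t1 r v a b := by
  have h := Rrow_eq t0 t1 r (fun x => v x.1 x.2) a b
  simpa only [Matrix.mulVec, dotProduct, Fintype.sum_prod_type] using h

lemma lift12_mulVec (t0 t1 r : K) (v : Fin 4 × Fin 4 × Fin 4 → K) (a b c : Fin 4) :
    (lift12 (RL1 t0 t1 r) *ᵥ v) (a, b, c) = Rrow t0 t1 r (fun p q => v (p, q, c)) a b := by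
  rw [← Rrow_sum]
  simp [lift12, Matrix.mulVec, dotProduct, Fintype.sum_prod_type]

lemma lift23_mulVec (t0 t1 r : K) (v : Fin 4 × Fin 4 × Fin 4 → K) (a b c : Fin 4) :
    (lift23 (RL1 t0 t1 r) *ᵥ v) (a, b, c) = Rrow t0 t1 r (fun p q => v (a, p, q)) b c := by
  rw [← Rrow_sum]
  simp [lift23, Matrix.mulVec, dotProduct, Fintype.sum_prod_type]

lemma yb (t0 t1 r : K) (hr : r ≠ 0) :
    lift12 (RL1 t0 t1 r) * lift23 (RL1 t0 t1 r) * lift12 (RL1 t0 t1 r) =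
      lift23 (RL1 t0 t1 r) * lift12 (RL1 t0 t1 r) * lift23 (RL1 t0 t1 r) := by
  apply Matrix.toLin'.injective
  apply LinearMap.ext
  intro v
  simp only [Matrix.toLin'_apply, ← Matrix.mulVec_mulVec]
  ext ⟨a, b, c⟩
  simp only [lift12_mulVec, lift23_mulVec]
  revert a b c
  refine forall4 ⟨forall4 ⟨?_, ?_, ?_, ?_⟩, forall4 ⟨?_, ?_, ?_, ?_⟩,
    forall4 ⟨?_, ?_, ?_, ?_⟩, forall4 ⟨?_, ?_, ?_, ?_⟩⟩ <;>
    refine forall4 ⟨?_, ?_, ?_, ?_⟩ <;>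
    simp only [Rrow] <;> first | ring1 | (field_simp <;> ring1)

lemma hL1_eq (s0 s1 : K) :
    hL1 s0 s1 = Matrix.diagonal ![s0 * s1, -(s0 * s1), -(s0 * s1), s0 * s1] := by
  ext i j
  fin_cases i <;> fin_cases j <;> simp [hL1]

lemma hL1_inv (s0 s1 : K) (hs0 : s0 ≠ 0) (hs1 : s1 ≠ 0) :
    (hL1 s0 s1)⁻¹ = Matrix.diagonal
      ![(s0 * s1)⁻¹, -(s0 * s1)⁻¹, -(s0 * s1)⁻¹, (s0 * s1)⁻¹] := by
  apply Matrix.inv_eq_right_inv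
  rw [hL1_eq, Matrix.diagonal_mul_diagonal, ← Matrix.diagonal_one]
  congr 1
  ext i
  fin_cases i <;> simp <;> field_simp

lemma RL1til_inv (s0 s1 r : K) (hs0 : s0 ≠ 0) (hs1 : s1 ≠ 0) (hr : r ≠ 0) :
    (RL1til s0 s1 r)⁻¹ = (s0 * s1)⁻¹ • SL1 (s0 ^ 2) (s1 ^ 2) r := by
  apply Matrix.inv_eq_right_inv
  rw [RL1til, Matrix.smul_mul, Matrix.mul_smul, mul_SL1 _ _ _ hr, smul_smul, smul_smul]
  have : (s0 * s1)⁻¹ * ((s0 * s1)⁻¹ * (s0 ^ 2 * s1 ^ 2)) = 1 := by field_simp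
  rw [mul_assoc, this, one_smul]


/-- `(R̃_{Λ₁}, h_{Λ₁})` is an enhanced R-matrix: commutation with
`h ⊗ h`, the two partial trace identities, the rotation identity, and the
Yang–Baxter equation. -/
theorem Lambda1_enhanced (s0 s1 r : K) (hs0 : s0 ≠ 0) (hs1 : s1 ≠ 0) (hr : r ≠ 0) :
    RL1til s0 s1 r * (hL1 s0 s1 ⊗ₖ hL1 s0 s1) = (hL1 s0 s1 ⊗ₖ hL1 s0 s1) * RL1til s0 s1 r ∧
    ptr2 (((1 : Matrix (Fin 4) (Fin 4) K) ⊗ₖ hL1 s0 s1) * RL1til s0 s1 r) = 1 ∧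
    ptr2 (((1 : Matrix (Fin 4) (Fin 4) K) ⊗ₖ hL1 s0 s1) * (RL1til s0 s1 r)⁻¹) = 1 ∧
    rotL ((RL1til s0 s1 r)⁻¹) *
        rotR (((1 : Matrix (Fin 4) (Fin 4) K) ⊗ₖ hL1 s0 s1) * RL1til s0 s1 r *
          ((hL1 s0 s1)⁻¹ ⊗ₖ (1 : Matrix (Fin 4) (Fin 4) K))) = 1 ∧
    lift12 (RL1til s0 s1 r) * lift23 (RL1til s0 s1 r) * lift12 (RL1til s0 s1 r) =
      lift23 (RL1til s0 s1 r) * lift12 (RL1til s0 s1 r) * lift23 (RL1til s0 s1 r) := by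
  have hone : (1 : Matrix (Fin 4) (Fin 4) K) = Matrix.diagonal (fun _ => 1) :=
    Matrix.diagonal_one.symm
  refine ⟨?_, ?_, ?_, ?_, ?_⟩
  · rw [hL1_eq, Matrix.diagonal_kronecker_diagonal]
    ext ⟨a, b⟩ ⟨i, j⟩
    rw [Matrix.mul_diagonal, Matrix.diagonal_mul]
    fin_cases a <;> fin_cases b <;> fin_cases i <;> fin_cases j <;>
      simp [RL1til, RL1_apply, RTab] <;> ring
  · rw [hL1_eq, hone, Matrix.diagonal_kronecker_diagonal]
    ext i j
    simp only [ptr2, Matrix.of_apply, Matrix.diagonal_mul, Fin.sum_univ_four]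
    fin_cases i <;> fin_cases j <;>
      simp [RL1til, RL1_apply, RTab] <;> field_simp <;> ring
  · rw [RL1til_inv _ _ _ hs0 hs1 hr, hL1_eq, hone, Matrix.diagonal_kronecker_diagonal]
    ext i j
    simp only [ptr2, Matrix.of_apply, Matrix.diagonal_mul, Fin.sum_univ_four]
    fin_cases i <;> fin_cases j <;>
      simp [SL1, STab] <;> field_simp <;> ring
  · rw [RL1til_inv _ _ _ hs0 hs1 hr, hL1_inv _ _ hs0 hs1, hL1_eq]
    have hM : (1 : Matrix (Fin 4) (Fin 4) K) ⊗ₖ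
          Matrix.diagonal ![s0 * s1, -(s0 * s1), -(s0 * s1), s0 * s1] * RL1til s0 s1 r *
          (Matrix.diagonal ![(s0 * s1)⁻¹, -(s0 * s1)⁻¹, -(s0 * s1)⁻¹, (s0 * s1)⁻¹] ⊗ₖ
            (1 : Matrix (Fin 4) (Fin 4) K)) =
        (s0 * s1)⁻¹ • ML1 (s0 ^ 2) (s1 ^ 2) r := by
      have h1 : (![s0 * s1, -(s0 * s1), -(s0 * s1), s0 * s1] : Fin 4 → K) =
          fun i => (s0 * s1) * ![1, -1, -1, 1] i := by
        ext i; fin_cases i <;> simp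
      have h2 : (![(s0 * s1)⁻¹, -(s0 * s1)⁻¹, -(s0 * s1)⁻¹, (s0 * s1)⁻¹] : Fin 4 → K) =
          fun i => (s0 * s1)⁻¹ * ![1, -1, -1, 1] i := by
        ext i; fin_cases i <;> simp
      rw [hone, Matrix.diagonal_kronecker_diagonal, Matrix.diagonal_kronecker_diagonal, h1, h2]
      ext p q
      rw [Matrix.mul_diagonal, Matrix.diagonal_mul]
      simp only [RL1til, ML1, Matrix.smul_apply, Matrix.of_apply, smul_eq_mul]
      field_simp
    rw [hM]
    have hL : ∀ (c : K) (A : Matrix (Fin 4 × Fin 4) (Fin 4 × Fin 4) K),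
        rotL (c • A) = c • rotL A := fun _ _ => rfl
    have hR : ∀ (c : K) (A : Matrix (Fin 4 × Fin 4) (Fin 4 × Fin 4) K),
        rotR (c • A) = c • rotR A := fun _ _ => rfl
    rw [hL, hR, Matrix.smul_mul, Matrix.mul_smul, rot_mul _ _ _ hr, smul_smul, smul_smul]
    have : (s0 * s1)⁻¹ * ((s0 * s1)⁻¹ * (s0 ^ 2 * s1 ^ 2)) = 1 := by field_simp
    rw [mul_assoc, this, one_smul]
  · have h12 : ∀ (c : K) (A : Matrix (Fin 4 × Fin 4) (Fin 4 × Fin 4) K),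
        lift12 (c • A) = c • lift12 A := by
      intro c A; ext p q; simp [lift12]
    have h23 : ∀ (c : K) (A : Matrix (Fin 4 × Fin 4) (Fin 4 × Fin 4) K),
        lift23 (c • A) = c • lift23 A := by
      intro c A; ext p q; simp [lift23]
    simp only [RL1til, h12, h23, Matrix.smul_mul, Matrix.mul_smul]
    rw [yb _ _ _ hr]
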